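/- Let m ≥ 1, D ⊆ ℝ^m, y ∈ D, and let r : ℝ^m → ℝ be differentiable at y with r(y) = 0 and r(y') ≤ 0 for every y' ∈ D. Set n := ∇r(y). Then limsup_{δ → 0⁺} (1/δ) · sup{ ⟨n, y' − y⟩ : y' ∈ D, ‖y' − y‖ ≤ δ } ≤ 0. -/

import Mathlib

open scoped RealInnerProductSpace

/-- inequality (5.1), the crucial first-order optimality observation.
If `y ∈ D`, `r` is differentiable at `y` with `r(y) = 0` and `r ≤ 0` on `D`, and
`n := ∇r(y)`, then
`limsup_{δ → 0⁺} (1/δ) · sup{ ⟨n, y' − y⟩ : y' ∈ D, ‖y' − y‖ ≤ δ } ≤ 0`. -/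
theorem stmt_11 (m : ℕ) (hm : 1 ≤ m) (D : Set (EuclideanSpace ℝ (Fin m)))
    (y : EuclideanSpace ℝ (Fin m)) (hy : y ∈ D)
    (r : EuclideanSpace ℝ (Fin m) → ℝ) (hdiff : DifferentiableAt ℝ r y)
    (hry : r y = 0) (hrD : ∀ y' ∈ D, r y' ≤ 0) :
    Filter.limsup
      (fun δ : ℝ => (1 / δ) *
        sSup ((fun y' => ⟪gradient r y, y' - y⟫) '' {y' | y' ∈ D ∧ ‖y' - y‖ ≤ δ}))
      (nhdsWithin 0 (Set.Ioi 0)) ≤ 0 := by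
  have key : ∀ ε : ℝ, 0 < ε → ∀ᶠ δ : ℝ in nhdsWithin 0 (Set.Ioi 0), 0 < δ ∧
      ∀ x ∈ ((fun y' => ⟪gradient r y, y' - y⟫) '' {y' | y' ∈ D ∧ ‖y' - y‖ ≤ δ}),
        x ≤ ε * δ := by
    intro ε hε
    have hg := (hasGradientAt_iff_isLittleO.1 hdiff.hasGradientAt).def hε
    obtain ⟨η, hη, hball⟩ := Metric.eventually_nhds_iff.1 hg
    filter_upwards [Ioo_mem_nhdsGT hη] with δ hδ
    refine ⟨hδ.1, ?_⟩
    rintro x ⟨z, ⟨hzD, hz⟩, rfl⟩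
    have h1 := hball (y := z) (by rw [dist_eq_norm]; exact lt_of_le_of_lt hz hδ.2)
    rw [Real.norm_eq_abs] at h1
    have h2 := (abs_le.1 h1).1
    have h3 := hrD z hzD
    have h4 : ε * ‖z - y‖ ≤ ε * δ := mul_le_mul_of_nonneg_left hz hε.le
    show ⟪gradient r y, z - y⟫ ≤ ε * δ
    linarith
  have hmem : ∀ δ : ℝ, 0 < δ → (0 : ℝ) ∈
      ((fun y' => ⟪gradient r y, y' - y⟫) '' {y' | y' ∈ D ∧ ‖y' - y‖ ≤ δ}) :=
    fun δ hδ => ⟨y, ⟨hy, by simpa using hδ.le⟩, by simp⟩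
  refine le_of_forall_pos_le_add fun ε hε => ?_
  rw [zero_add]
  refine Filter.limsup_le_of_le ?_ ?_
  · refine Filter.IsBoundedUnder.isCoboundedUnder_le ⟨0, ?_⟩
    rw [Filter.eventually_map]
    filter_upwards [key ε hε] with δ hδ
    exact mul_nonneg (one_div_nonneg.2 hδ.1.le) (le_csSup ⟨_, hδ.2⟩ (hmem δ hδ.1))
  · filter_upwards [key ε hε] with δ hδ
    have h := csSup_le ⟨0, hmem δ hδ.1⟩ hδ.2
    rw [one_div, inv_mul_le_iff₀ hδ.1, mul_comm]
    exact h
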